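/- Let n ≥ 2 and let β be an alternating bilinear map on V = ℝⁿ ⊕ skew(n) with values in V satisfying: (i) β((x,0),(y,0)) = (0, x∧y) for all x, y ∈ ℝⁿ; (ii) β((x,0),(0,B)) ∈ ℝⁿ ⊕ {0} for all x ∈ ℝⁿ, B ∈ skew(n), and β((0,A),(0,B)) ∈ {0} ⊕ skew(n) for all A, B ∈ skew(n); (iii) for every q ∈ O(n), β(ψ(q)u, ψ(q)v) = ψ(q)β(u, v) for all u, v ∈ V, where ψ(q)(x, A) := (qx, qAqᵀ). Then there exist constants ρ₁, ρ₂ ∈ ℝ such that β((x, A), (y, B)) = (ρ₁(Ay − Bx), x∧y + ρ₂(AB − BA)) for all (x,A), (y,B) ∈ V. -/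

import Mathlib

open Matrix

/-- The space `skew(n)` of skew-symmetric real `n × n` matrices. -/
def Skew (n : ℕ) : Submodule ℝ (Matrix (Fin n) (Fin n) ℝ) where
  carrier := {A | Aᵀ = -A}
  add_mem' := by
    intro a b ha hb
    simp only [Set.mem_setOf_eq] at *
    rw [Matrix.transpose_add, ha, hb, neg_add]
  zero_mem' := by simp
  smul_mem' := by
    intro c A hA
    simp only [Set.mem_setOf_eq] at *
    rw [Matrix.transpose_smul, hA, smul_neg]

lemma conj_mem {n : ℕ} (q : Matrix (Fin n) (Fin n) ℝ) {A : Matrix (Fin n) (Fin n) ℝ}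
    (hA : A ∈ Skew n) : q * A * qᵀ ∈ Skew n := by
  have h : Aᵀ = -A := hA
  show (q * A * qᵀ)ᵀ = -(q * A * qᵀ)
  rw [Matrix.transpose_mul, Matrix.transpose_mul, Matrix.transpose_transpose, h]
  simp [Matrix.mul_assoc]

/-- Conjugation `A ↦ q A qᵀ` on skew-symmetric matrices. -/
def conjS {n : ℕ} (q : Matrix (Fin n) (Fin n) ℝ) (A : Skew n) : Skew n :=
  ⟨q * A.val * qᵀ, conj_mem q A.2⟩

/-- `x ∧ y := y xᵀ − x yᵀ`. -/
def wedge {n : ℕ} (x y : Fin n → ℝ) : Matrix (Fin n) (Fin n) ℝ :=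
  Matrix.vecMulVec y x - Matrix.vecMulVec x y

lemma wedge_mem {n : ℕ} (x y : Fin n → ℝ) : wedge x y ∈ Skew n := by
  show (wedge x y)ᵀ = -(wedge x y)
  ext i j
  simp [wedge, Matrix.vecMulVec_apply, Matrix.transpose_apply, Matrix.sub_apply, Matrix.neg_apply]
  ring

/-- `x ∧ y` as an element of `skew(n)`. -/
def wedgeS {n : ℕ} (x y : Fin n → ℝ) : Skew n := ⟨wedge x y, wedge_mem x y⟩

lemma comm_mem {n : ℕ} {A B : Matrix (Fin n) (Fin n) ℝ} (hA : A ∈ Skew n) (hB : B ∈ Skew n) :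
    A * B - B * A ∈ Skew n := by
  have hA' : Aᵀ = -A := hA
  have hB' : Bᵀ = -B := hB
  show (A * B - B * A)ᵀ = -(A * B - B * A)
  rw [Matrix.transpose_sub, Matrix.transpose_mul, Matrix.transpose_mul, hA', hB']
  simp [neg_sub]

/-- The commutator `AB − BA` as an element of `skew(n)`. -/
def commS {n : ℕ} (A B : Skew n) : Skew n :=
  ⟨A.val * B.val - B.val * A.val, comm_mem A.2 B.2⟩

/-- The signed permutation matrix sending `e_b` to `ε b • e_{σ b}`. -/
def signedPerm {n : ℕ} (ε : Fin n → ℝ) (σ : Equiv.Perm (Fin n)) : Matrix (Fin n) (Fin n) ℝ :=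
  Matrix.of fun a b => if a = σ b then ε b else 0

lemma signedPerm_orthogonal {n : ℕ} {ε : Fin n → ℝ} (hε : ∀ i, ε i * ε i = 1)
    (σ : Equiv.Perm (Fin n)) : (signedPerm ε σ)ᵀ * signedPerm ε σ = 1 := by
  ext i j
  rcases eq_or_ne i j with rfl | hij
  · simp [signedPerm, Matrix.mul_apply, hε]
  · simp [signedPerm, Matrix.mul_apply, hij, hij.symm]

lemma signedPerm_mulVec_single {n : ℕ} (ε : Fin n → ℝ) (σ : Equiv.Perm (Fin n)) (k : Fin n) :
    (signedPerm ε σ).mulVec (Pi.single k 1) = ε k • Pi.single (σ k) 1 := by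
  ext a
  simp [signedPerm, Pi.single_apply]

lemma signedPerm_mulVec_apply {n : ℕ} (ε : Fin n → ℝ) (σ : Equiv.Perm (Fin n)) (v : Fin n → ℝ)
    (l : Fin n) : (signedPerm ε σ).mulVec v (σ l) = ε l * v l := by
  simp [signedPerm, Matrix.mulVec, dotProduct]

lemma signedPerm_conj_apply {n : ℕ} (ε : Fin n → ℝ) (σ : Equiv.Perm (Fin n))
    (A : Skew n) (a b : Fin n) :
    (conjS (signedPerm ε σ) A).val (σ a) (σ b) = ε a * ε b * A.val a b := by
  simp only [conjS]
  simp [signedPerm, Matrix.mul_apply]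
  ring

lemma conjS_wedgeS {n : ℕ} (q : Matrix (Fin n) (Fin n) ℝ) (x y : Fin n → ℝ) :
    conjS q (wedgeS x y) = wedgeS (q.mulVec x) (q.mulVec y) := by
  apply Subtype.ext
  simp [conjS, wedgeS, wedge, Matrix.mul_sub, Matrix.sub_mul, Matrix.mul_vecMulVec,
    Matrix.vecMulVec_mul, Matrix.vecMul_transpose]

lemma wedgeS_smul_smul {n : ℕ} (a b : ℝ) (x y : Fin n → ℝ) :
    wedgeS (a • x) (b • y) = (a * b) • wedgeS x y := by
  apply Subtype.ext
  ext i j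
  simp [wedgeS, wedge, Matrix.vecMulVec_apply]
  ring

/-- The elementary skew-symmetric matrix `e_i ∧ e_j`. -/
def skewUnit {n : ℕ} (i j : Fin n) : Skew n := wedgeS (Pi.single i 1) (Pi.single j 1)

lemma skewUnit_apply {n : ℕ} (i j a b : Fin n) :
    (skewUnit i j).val a b
      = (if a = j then 1 else 0) * (if b = i then 1 else 0)
        - (if a = i then 1 else 0) * (if b = j then 1 else 0) := by
  simp [skewUnit, wedgeS, wedge, Matrix.vecMulVec_apply, Pi.single_apply]

lemma skewUnit_swap {n : ℕ} (i j : Fin n) : skewUnit j i = -skewUnit i j := by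
  apply Subtype.ext
  simp [skewUnit, wedgeS, wedge]

lemma conjS_signedPerm_skewUnit {n : ℕ} (ε : Fin n → ℝ) (σ : Equiv.Perm (Fin n)) (i j : Fin n) :
    conjS (signedPerm ε σ) (skewUnit i j) = (ε i * ε j) • skewUnit (σ i) (σ j) := by
  simp only [skewUnit, conjS_wedgeS, signedPerm_mulVec_single, wedgeS_smul_smul]

lemma Skew.apply_swap {n : ℕ} (A : Skew n) (i j : Fin n) : A.val j i = -A.val i j :=
  congrFun (congrFun A.2 i) j

lemma Skew.eq_sum_skewUnit {n : ℕ} (A : Skew n) :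
    A = ∑ i, ∑ j, (2⁻¹ * A.val j i) • skewUnit i j := by
  apply Subtype.ext
  ext a b
  simp only [Submodule.coe_sum, Submodule.coe_smul, Matrix.sum_apply, Matrix.smul_apply,
    skewUnit_apply, smul_eq_mul, mul_sub, Finset.sum_sub_distrib]
  simp [Skew.apply_swap A a b]
  ring

/-- A property of skew-symmetric matrices closed under linear combinations holds everywhere
once it holds for the matrices `e_i ∧ e_j`. -/
lemma Skew.induction {n : ℕ} {P : Skew n → Prop} (zero : P 0)
    (add : ∀ A B, P A → P B → P (A + B)) (smul : ∀ (c : ℝ) A, P A → P (c • A))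
    (unit : ∀ i j, P (skewUnit i j)) (A : Skew n) : P A := by
  rw [Skew.eq_sum_skewUnit A]
  exact Finset.sum_induction _ P add zero fun i _ =>
    Finset.sum_induction _ P add zero fun j _ => smul _ _ (unit i j)

lemma pi_induction {n : ℕ} {P : (Fin n → ℝ) → Prop} (zero : P 0)
    (add : ∀ x y, P x → P y → P (x + y)) (smul : ∀ (c : ℝ) x, P x → P (c • x))
    (single : ∀ i, P (Pi.single i 1)) (x : Fin n → ℝ) : P x := by
  rw [pi_eq_sum_univ' x]
  refine Finset.sum_induction _ P add zero fun i _ => smul _ _ ?_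
  convert single i using 1

lemma commS_add_left {n : ℕ} (A A' B : Skew n) :
    commS (A + A') B = commS A B + commS A' B := by
  apply Subtype.ext
  simp only [commS, Submodule.coe_add]
  noncomm_ring

lemma commS_add_right {n : ℕ} (A B B' : Skew n) :
    commS A (B + B') = commS A B + commS A B' := by
  apply Subtype.ext
  simp only [commS, Submodule.coe_add]
  noncomm_ring

lemma commS_smul_left {n : ℕ} (c : ℝ) (A B : Skew n) : commS (c • A) B = c • commS A B := by
  apply Subtype.ext
  simp [commS, smul_sub]

lemma commS_smul_right {n : ℕ} (c : ℝ) (A B : Skew n) : commS A (c • B) = c • commS A B := by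
  apply Subtype.ext
  simp [commS, smul_sub]

lemma commS_zero_left {n : ℕ} (B : Skew n) : commS 0 B = 0 := by
  apply Subtype.ext
  simp [commS]

lemma commS_zero_right {n : ℕ} (A : Skew n) : commS A 0 = 0 := by
  apply Subtype.ext
  simp [commS]

lemma exists_perm_pair {α : Type*} {i j k l : α} (hij : i ≠ j) (hkl : k ≠ l) :
    ∃ σ : Equiv.Perm α, σ i = k ∧ σ j = l := by
  classical
  refine ⟨(Equiv.swap i k).trans (Equiv.swap (Equiv.swap i k j) l), ?_, ?_⟩
  · simp only [Equiv.trans_apply, Equiv.swap_apply_left]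
    apply Equiv.swap_apply_of_ne_of_ne _ hkl
    grind
  · simp

lemma exists_perm_triple {α : Type*} {i j k i' j' k' : α} (hij : i ≠ j) (hjk : j ≠ k)
    (hik : i ≠ k) (hij' : i' ≠ j') (hjk' : j' ≠ k') (hik' : i' ≠ k') :
    ∃ σ : Equiv.Perm α, σ i = i' ∧ σ j = j' ∧ σ k = k' := by
  classical
  obtain ⟨σ, hi, hj⟩ := exists_perm_pair hij hij'
  have h1 : σ k ≠ i' := by rw [← hi]; exact σ.injective.ne hik.symm
  have h2 : σ k ≠ j' := by rw [← hj]; exact σ.injective.ne hjk.symm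
  refine ⟨σ.trans (Equiv.swap (σ k) k'), ?_, ?_, ?_⟩
  · simp [hi, Equiv.swap_apply_of_ne_of_ne h1.symm hik']
  · simp [hj, Equiv.swap_apply_of_ne_of_ne h2.symm hjk']
  · simp

/-- The sign vector flipping the coordinate `m`. -/
def flipSign {n : ℕ} (m i : Fin n) : ℝ := if i = m then -1 else 1

lemma flipSign_mul_self {n : ℕ} (m i : Fin n) : flipSign m i * flipSign m i = 1 := by
  unfold flipSign; split_ifs <;> norm_num

/-- Signed-permutation-invariant tensors of order four, antisymmetric in the middle slots. -/
lemma invariant_four {n : ℕ} (f : Fin n → Fin n → Fin n → Fin n → ℝ)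
    (hsw : ∀ k i j l, f k j i l = -f k i j l)
    (hinv : ∀ (ε : Fin n → ℝ) (σ : Equiv.Perm (Fin n)), (∀ i, ε i * ε i = 1) → ∀ k i j l,
      ε k * (ε i * ε j) * f (σ k) (σ i) (σ j) (σ l) = ε l * f k i j l) :
    ∃ c : ℝ, ∀ k i j l, f k i j l =
      c * ((if l = j then 1 else 0) * (if k = i then 1 else 0)
        - (if l = i then 1 else 0) * (if k = j then 1 else 0)) := by
  have hperm (σ : Equiv.Perm (Fin n)) (k i j l) :
      f (σ k) (σ i) (σ j) (σ l) = f k i j l := by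
    simpa using hinv (fun _ => 1) σ (by simp) k i j l
  have hflip (m k i j l) :
      flipSign m k * (flipSign m i * flipSign m j) * f k i j l = flipSign m l * f k i j l := by
    simpa using hinv (flipSign m) 1 (flipSign_mul_self m) k i j l
  have hdiag (i j) : f i i i j = 0 := by linarith [hsw i i i j]
  obtain ⟨c, hc⟩ : ∃ c, ∀ i j, i ≠ j → f i i j j = c := by
    by_cases h : ∃ i j : Fin n, i ≠ j
    · obtain ⟨i, j, hij⟩ := h
      refine ⟨f i i j j, fun k l hkl => ?_⟩
      obtain ⟨σ, rfl, rfl⟩ := exists_perm_pair hij hkl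
      exact hperm σ i i j j
    · push Not at h
      exact ⟨0, fun i j hij => absurd (h i j) hij⟩
  refine ⟨c, fun k i j l => ?_⟩
  have hi := hflip i k i j l
  have hj := hflip j k i j l
  have hk := hflip k k i j l
  have hl := hflip l k i j l
  have hs := hsw k i j l
  have hci := hc i j
  have hcj := hc j i
  unfold flipSign at hi hj hk hl
  by_cases hij : i = j
  · subst hij
    have : f k i i l = 0 := by linarith
    rw [this]; ring
  · grind

lemma commS_skewUnit_apply {n : ℕ} (i j k l a b : Fin n) :
    (commS (skewUnit i j) (skewUnit k l)).val a b
      = (if i = l then (skewUnit k j).val a b else 0)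
        - (if i = k then (skewUnit l j).val a b else 0)
        - (if j = l then (skewUnit k i).val a b else 0)
        + (if j = k then (skewUnit l i).val a b else 0) := by
  simp only [commS, Matrix.sub_apply, Matrix.mul_apply, skewUnit_apply, mul_sub, sub_mul,
    Finset.sum_sub_distrib]
  simp
  grind

/-- Signed-permutation-invariant tensors of order six, antisymmetric in three pairs of slots. -/
lemma invariant_six {n : ℕ} (g : Fin n → Fin n → Fin n → Fin n → Fin n → Fin n → ℝ)
    (hsw1 : ∀ i j k l a b, g j i k l a b = -g i j k l a b)
    (hsw2 : ∀ i j k l a b, g i j l k a b = -g i j k l a b)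
    (hsw3 : ∀ i j k l a b, g i j k l b a = -g i j k l a b)
    (hinv : ∀ (ε : Fin n → ℝ) (σ : Equiv.Perm (Fin n)), (∀ i, ε i * ε i = 1) → ∀ i j k l a b,
      (ε i * ε j) * (ε k * ε l) * g (σ i) (σ j) (σ k) (σ l) (σ a) (σ b)
        = ε a * ε b * g i j k l a b) :
    ∃ d : ℝ, ∀ i j k l a b, g i j k l a b = d * (commS (skewUnit i j) (skewUnit k l)).val a b := by
  have hperm (σ : Equiv.Perm (Fin n)) (i j k l a b) :
      g (σ i) (σ j) (σ k) (σ l) (σ a) (σ b) = g i j k l a b := by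
    simpa using hinv (fun _ => 1) σ (by simp) i j k l a b
  have hflip (m i j k l a b) :
      (flipSign m i * flipSign m j) * (flipSign m k * flipSign m l) * g i j k l a b
        = flipSign m a * flipSign m b * g i j k l a b := by
    simpa using hinv (flipSign m) 1 (flipSign_mul_self m) i j k l a b
  obtain ⟨d, hd⟩ : ∃ d, ∀ p q r, p ≠ q → q ≠ r → p ≠ r → g p q q r p r = d := by
    by_cases h : ∃ p q r : Fin n, p ≠ q ∧ q ≠ r ∧ p ≠ r
    · obtain ⟨p, q, r, hpq, hqr, hpr⟩ := h
      refine ⟨g p q q r p r, fun p' q' r' hpq' hqr' hpr' => ?_⟩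
      obtain ⟨σ, rfl, rfl, rfl⟩ := exists_perm_triple hpq hqr hpr hpq' hqr' hpr'
      exact hperm σ p q q r p r
    · push Not at h
      exact ⟨0, fun p q r hpq hqr hpr => absurd (h p q r hpq hqr) hpr⟩
  have hself1 (i k l a b) : g i i k l a b = 0 := by linarith [hsw1 i i k l a b]
  have hself2 (i j k a b) : g i j k k a b = 0 := by linarith [hsw2 i j k k a b]
  have hself3 (i j k l a) : g i j k l a a = 0 := by linarith [hsw3 i j k l a a]
  have hdisj (i j k l a b) (hik : i ≠ k) (hil : i ≠ l) (hjk : j ≠ k) (hjl : j ≠ l) :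
      g i j k l a b = 0 := by
    have hi := hflip i i j k l a b
    have hj := hflip j i j k l a b
    have hk := hflip k i j k l a b
    unfold flipSign at hi hj hk
    grind
  have hadj (i j l a b) : g i j j l a b = d * (commS (skewUnit i j) (skewUnit j l)).val a b := by
    rw [commS_skewUnit_apply]
    simp only [skewUnit_apply]
    have hi := hflip i i j j l a b
    have hl := hflip l i j j l a b
    have ha := hflip a i j j l a b
    have hsw := hsw3 i j j l i l
    have hdd := hd i j l
    unfold flipSign at hi hl ha
    by_cases hij : i = j
    · subst hij
      rw [hself1]; grind
    by_cases hjl : j = l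
    · subst hjl
      rw [hself2]; grind
    by_cases hab : a = b
    · subst hab
      rw [hself3]; grind
    grind
  refine ⟨d, fun i j k l a b => ?_⟩
  by_cases hjk : j = k
  · subst hjk
    exact hadj i j l a b
  by_cases hik : i = k
  · subst hik
    have h1 := hadj j i l a b
    have h2 := hsw1 i j i l a b
    rw [commS_skewUnit_apply] at h1 ⊢
    simp only [skewUnit_apply] at h1 ⊢
    grind
  by_cases hjl : j = l
  · subst hjl
    have h1 := hadj i j k a b
    have h2 := hsw2 i j j k a b
    rw [commS_skewUnit_apply] at h1 ⊢
    simp only [skewUnit_apply] at h1 ⊢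
    grind
  by_cases hil : i = l
  · subst hil
    have h1 := hadj j i k a b
    have h2 := hsw1 j i i k a b
    have h3 := hsw2 i j i k a b
    rw [commS_skewUnit_apply] at h1 ⊢
    simp only [skewUnit_apply] at h1 ⊢
    grind
  rw [hdisj i j k l a b hik hil hjk hjl, commS_skewUnit_apply]
  simp [hik, hil, hjk, hjl]

/-- For `n ≥ 2`, any alternating bilinear map `β` on `V = ℝⁿ ⊕ skew(n)` with values in `V`
such that (i) `β((x,0),(y,0)) = (0, x∧y)`; (ii) `β((x,0),(0,B)) ∈ ℝⁿ ⊕ {0}` and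
`β((0,A),(0,B)) ∈ {0} ⊕ skew(n)`; and (iii) `β` is equivariant under
`ψ(q)(x, A) = (qx, qAqᵀ)` for every `q ∈ O(n)`, is of the form
`β((x,A),(y,B)) = (ρ₁(Ay − Bx), x∧y + ρ₂(AB − BA))` for some constants `ρ₁, ρ₂`. -/
theorem equivariant_bracket_classification (n : ℕ) (hn : 2 ≤ n)
    (β : ((Fin n → ℝ) × Skew n) →ₗ[ℝ] ((Fin n → ℝ) × Skew n) →ₗ[ℝ] ((Fin n → ℝ) × Skew n))
    (halt : ∀ u : (Fin n → ℝ) × Skew n, β u u = 0)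
    (h1 : ∀ x y : Fin n → ℝ, β (x, 0) (y, 0) = (0, wedgeS x y))
    (h2a : ∀ (x : Fin n → ℝ) (B : Skew n), (β (x, 0) (0, B)).2 = 0)
    (h2b : ∀ A B : Skew n, (β (0, A) (0, B)).1 = 0)
    (h3 : ∀ q : Matrix (Fin n) (Fin n) ℝ, qᵀ * q = 1 →
        ∀ u v : (Fin n → ℝ) × Skew n,
          β (q.mulVec u.1, conjS q u.2) (q.mulVec v.1, conjS q v.2)
            = (q.mulVec (β u v).1, conjS q (β u v).2)) :
    ∃ ρ₁ ρ₂ : ℝ, ∀ (x y : Fin n → ℝ) (A B : Skew n),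
      β (x, A) (y, B)
        = (ρ₁ • (A.val.mulVec y - B.val.mulVec x), wedgeS x y + ρ₂ • commS A B) := by
  have hsmul (x : Fin n → ℝ) (c : ℝ) :
      ((c • x, 0) : (Fin n → ℝ) × Skew n) = c • (x, 0) := by simp
  have hsmul' (A : Skew n) (c : ℝ) :
      ((0, c • A) : (Fin n → ℝ) × Skew n) = c • (0, A) := by simp
  have hadd (x y : Fin n → ℝ) :
      ((x + y, 0) : (Fin n → ℝ) × Skew n) = (x, 0) + (y, 0) := by simp
  have hadd' (A B : Skew n) :
      ((0, A + B) : (Fin n → ℝ) × Skew n) = (0, A) + (0, B) := by simp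
  have hneg (A : Skew n) :
      ((0, -A) : (Fin n → ℝ) × Skew n) = -(0, A) := by simp
  have hzero : ((0, 0) : (Fin n → ℝ) × Skew n) = 0 := rfl
  have hconj0 (q : Matrix (Fin n) (Fin n) ℝ) : conjS q (0 : Skew n) = 0 := by
    apply Subtype.ext; simp [conjS]
  obtain ⟨c, hc⟩ := invariant_four
    (fun k i j l => (β (Pi.single k 1, 0) (0, skewUnit i j)).1 l)
    (by
      intro k i j l
      simp only [skewUnit_swap i j, hneg, map_neg, Prod.fst_neg, Pi.neg_apply])
    (by
      intro ε σ hε k i j l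
      have h := congrArg (fun v => v.1 (σ l)) (h3 _ (signedPerm_orthogonal hε σ)
        (Pi.single k 1, 0) (0, skewUnit i j))
      simp only [signedPerm_mulVec_single, hconj0, Matrix.mulVec_zero, signedPerm_mulVec_apply,
        conjS_signedPerm_skewUnit, hsmul, hsmul', map_smul, LinearMap.smul_apply, Prod.smul_fst,
        Pi.smul_apply, smul_eq_mul] at h
      linarith)
  obtain ⟨d, hd⟩ := invariant_six
    (fun i j k l a b => (β (0, skewUnit i j) (0, skewUnit k l)).2.val a b)
    (by
      intro i j k l a b
      simp [skewUnit_swap i j, hneg, -Prod.neg_mk])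
    (by
      intro i j k l a b
      simp [skewUnit_swap k l, hneg, -Prod.neg_mk])
    (by
      intro i j k l a b
      exact Skew.apply_swap _ a b)
    (by
      intro ε σ hε i j k l a b
      have h := congrArg (fun v => v.2.val (σ a) (σ b)) (h3 _ (signedPerm_orthogonal hε σ)
        (0, skewUnit i j) (0, skewUnit k l))
      simp only [Matrix.mulVec_zero, conjS_signedPerm_skewUnit, hsmul', map_smul,
        LinearMap.smul_apply, Prod.smul_snd, Submodule.coe_smul, Matrix.smul_apply, smul_eq_mul]
        at h
      have h' := signedPerm_conj_apply ε σ (β (0, skewUnit i j) (0, skewUnit k l)).2 a b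
      linarith)
  have hvec (x : Fin n → ℝ) (B : Skew n) : β (x, 0) (0, B) = (c • B.val.mulVec x, 0) := by
    refine Prod.ext ?_ (h2a x B)
    induction B using Skew.induction with
    | zero => simp [hzero]
    | add A B hA hB =>
      rw [hadd', map_add, Prod.fst_add, hA, hB]
      simp [Matrix.add_mulVec]
    | smul t A hA =>
      rw [hsmul', map_smul, Prod.smul_fst, hA]
      simp [Matrix.smul_mulVec, smul_comm t c]
    | unit i j =>
      induction x using pi_induction with
      | zero => simp [hzero]
      | add x y hx hy =>
        rw [hadd, map_add, LinearMap.add_apply, Prod.fst_add, hx, hy]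
        simp [Matrix.mulVec_add]
      | smul t x hx =>
        rw [hsmul, map_smul, LinearMap.smul_apply, Prod.smul_fst, hx]
        simp [Matrix.mulVec_smul, smul_comm t c]
      | single k =>
        ext l
        rw [hc k i j l]
        simp [skewUnit_apply]
  have hskew (A B : Skew n) : β (0, A) (0, B) = (0, d • commS A B) := by
    refine Prod.ext (h2b A B) ?_
    induction A using Skew.induction with
    | zero => simp [hzero, commS_zero_left]
    | add A A' hA hA' =>
      rw [hadd', map_add, LinearMap.add_apply, Prod.snd_add, hA, hA']
      simp [commS_add_left]
    | smul t A hA =>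
      rw [hsmul', map_smul, LinearMap.smul_apply, Prod.smul_snd, hA]
      simp [commS_smul_left, smul_comm t d]
    | unit i j =>
      induction B using Skew.induction with
      | zero => simp [hzero, commS_zero_right]
      | add B B' hB hB' =>
        rw [hadd', map_add, Prod.snd_add, hB, hB']
        simp [commS_add_right]
      | smul t B hB =>
        rw [hsmul', map_smul, Prod.smul_snd, hB]
        simp [commS_smul_right, smul_comm t d]
      | unit k l =>
        apply Subtype.ext
        ext a b
        rw [hd i j k l a b]
        simp
  have hflip (u v) : β u v = -β v u := by
    have h := halt (u + v)
    simp only [map_add, LinearMap.add_apply, halt, zero_add, add_zero] at h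
    exact eq_neg_of_add_eq_zero_right h
  refine ⟨-c, d, fun x y A B => ?_⟩
  have hx : ((x, A) : (Fin n → ℝ) × Skew n) = (x, 0) + (0, A) := by simp
  have hy : ((y, B) : (Fin n → ℝ) × Skew n) = (y, 0) + (0, B) := by simp
  rw [hx, hy]
  simp only [map_add, LinearMap.add_apply]
  rw [h1, hvec, hskew, hflip (0, A), hvec]
  refine Prod.ext ?_ ?_
  · simp [smul_sub]
  · simp
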